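/- (Finite-blocklength guessing version, converse.) For every choice of Alice's encoder (a conditional PMF P(M₁ = m₁, M₂ = m₂ | X = x, Y = y)), Bob's guessing ambiguity satisfies 𝒜_B^g ≥ max( (1 + ln|𝒳|)^{−ρ} · 2^{ρ(H_{1/(1+ρ)}(X|Y) − log(|𝒨₁|·|𝒨₂|))}, 1 ), and the alternative Eve ambiguity satisfies Ã_E ≤ min( (min(|𝒨₁|,|𝒨₂|))^ρ · 𝒜_B^g, 2^{ρ H_{1/(1+ρ)}(X|Y)} ); since 𝒜_E ≤ Ã_E, the same upper bound holds for Eve's ambiguity 𝒜_E. -/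

import Mathlib

open scoped BigOperators

noncomputable section

/-- `G` is a guessing function for `X` given side information in `V`:
for every `v`, `G v` is a bijection from `X` onto `{1, …, |X|}`. -/
def IsGuess {X V : Type*} [Fintype X] (G : V → X → ℕ) : Prop :=
  ∀ v : V, Set.BijOn (G v) Set.univ (Set.Icc 1 (Fintype.card X))

/-- The conditional Rényi entropy `H_α(X|Y)` (base 2) of order `α = 1/(1+ρ)`. -/
def condRenyi {X Y : Type*} [Fintype X] [Fintype Y] (ρ : ℝ) (p : X → Y → ℝ) : ℝ :=
  ((1 / (1 + ρ)) / (1 - 1 / (1 + ρ))) *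
    Real.logb 2 (∑ y : Y, (∑ x : X, p x y ^ (1 / (1 + ρ))) ^ (1 / (1 / (1 + ρ))))

/-- Bob's guessing ambiguity `𝒜_B^g`: the least ρ-th moment of the number of guesses that
Bob, observing `(Y, M₁, M₂)`, needs to guess `X`. -/
def bobGuessAmb {𝒳 𝒴 M₁ M₂ : Type*} [Fintype 𝒳] [Fintype 𝒴] [Fintype M₁] [Fintype M₂]
    (ρ : ℝ) (p : 𝒳 → 𝒴 → ℝ) (e : 𝒳 → 𝒴 → M₁ × M₂ → ℝ) : ℝ :=
  sInf {r : ℝ | ∃ G : 𝒴 × M₁ × M₂ → 𝒳 → ℕ, IsGuess G ∧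
    r = ∑ x : 𝒳, ∑ y : 𝒴, ∑ m : M₁ × M₂, p x y * e x y m * (G (y, m) x : ℝ) ^ ρ}

/-- Bob's list ambiguity `𝒜_B^l`: the ρ-th moment of the size of the list of realizations
of `X` with positive posterior probability given `(Y, M₁, M₂)`. -/
def bobListAmb {𝒳 𝒴 M₁ M₂ : Type*} [Fintype 𝒳] [Fintype 𝒴] [Fintype M₁] [Fintype M₂]
    (ρ : ℝ) (p : 𝒳 → 𝒴 → ℝ) (e : 𝒳 → 𝒴 → M₁ × M₂ → ℝ) : ℝ :=
  ∑ x : 𝒳, ∑ y : 𝒴, ∑ m : M₁ × M₂, p x y * e x y m *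
    (((Finset.univ.filter fun x' : 𝒳 => 0 < p x' y * e x' y m).card : ℝ)) ^ ρ

/-- Eve's ambiguity `𝒜_E`: the least ρ-th moment of the number of guesses, where for every
realization the more informative of the two hints is used. -/
def eveAmb {𝒳 𝒴 M₁ M₂ : Type*} [Fintype 𝒳] [Fintype 𝒴] [Fintype M₁] [Fintype M₂]
    (ρ : ℝ) (p : 𝒳 → 𝒴 → ℝ) (e : 𝒳 → 𝒴 → M₁ × M₂ → ℝ) : ℝ :=
  sInf {r : ℝ | ∃ G₁ : 𝒴 × M₁ → 𝒳 → ℕ, ∃ G₂ : 𝒴 × M₂ → 𝒳 → ℕ, IsGuess G₁ ∧ IsGuess G₂ ∧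
    r = ∑ x : 𝒳, ∑ y : 𝒴, ∑ m₁ : M₁, ∑ m₂ : M₂, p x y * e x y (m₁, m₂) *
      ((min (G₁ (y, m₁) x) (G₂ (y, m₂) x) : ℕ) : ℝ) ^ ρ}

/-- The alternative (less conservative) Eve ambiguity `Ã_E`. -/
def eveAmbAlt {𝒳 𝒴 M₁ M₂ : Type*} [Fintype 𝒳] [Fintype 𝒴] [Fintype M₁] [Fintype M₂]
    (ρ : ℝ) (p : 𝒳 → 𝒴 → ℝ) (e : 𝒳 → 𝒴 → M₁ × M₂ → ℝ) : ℝ :=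
  min
    (sInf {r : ℝ | ∃ G₁ : 𝒴 × M₁ → 𝒳 → ℕ, IsGuess G₁ ∧
      r = ∑ x : 𝒳, ∑ y : 𝒴, ∑ m₁ : M₁, ∑ m₂ : M₂, p x y * e x y (m₁, m₂) *
        (G₁ (y, m₁) x : ℝ) ^ ρ})
    (sInf {r : ℝ | ∃ G₂ : 𝒴 × M₂ → 𝒳 → ℕ, IsGuess G₂ ∧
      r = ∑ x : 𝒳, ∑ y : 𝒴, ∑ m₁ : M₁, ∑ m₂ : M₂, p x y * e x y (m₁, m₂) *
        (G₂ (y, m₂) x : ℝ) ^ ρ})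

/-- Sorting a finite type by increasing values of `f` ranks each `x` among the elements with value
at most `f x`. -/
theorem exists_bijOn_le_card_filter_le {X β : Type*} [Fintype X] [LinearOrder β] (f : X → β) :
    ∃ g : X → ℕ, Set.BijOn g Set.univ (Set.Icc 1 (Fintype.card X)) ∧
      ∀ x, g x ≤ (Finset.univ.filter fun x' => f x' ≤ f x).card := by
  classical
  let φ : X → β ×ₗ Fin (Fintype.card X) := fun x => toLex (f x, Fintype.equivFin X x)
  have hφ : Function.Injective φ := fun a b h =>
    (Fintype.equivFin X).injective (congrArg (fun z => (ofLex z).2) h)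
  let g : X → ℕ := fun x => (Finset.univ.filter fun x' => φ x' ≤ φ x).card
  have hmono : ∀ a b, φ a < φ b → g a < g b := fun a b hab => by
    refine Finset.card_lt_card (Finset.ssubset_iff_of_subset ?_ |>.2 ⟨b, ?_, ?_⟩)
    · intro c hc
      simp only [Finset.mem_filter, Finset.mem_univ, true_and] at hc ⊢
      exact hc.trans hab.le
    · simp
    · simpa using hab
  have hinj : Function.Injective g := fun a b h => by
    rcases lt_trichotomy (φ a) (φ b) with h' | h' | h'
    · exact absurd h (hmono _ _ h').ne
    · exact hφ h'
    · exact absurd h (hmono _ _ h').ne'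
  have hmem : ∀ x, g x ∈ Finset.Icc 1 (Fintype.card X) := fun x => by
    refine Finset.mem_Icc.2 ⟨Finset.card_pos.2 ⟨x, by simp⟩, Finset.card_le_univ _⟩
  refine ⟨g, ⟨fun x _ => by simpa using hmem x, hinj.injOn, ?_⟩, fun x => ?_⟩
  · have himg : Finset.univ.image g = Finset.Icc 1 (Fintype.card X) := by
      refine Finset.eq_of_subset_of_card_le (fun n hn => ?_) ?_
      · obtain ⟨x, -, rfl⟩ := Finset.mem_image.1 hn
        exact hmem x
      · rw [Finset.card_image_of_injective _ hinj]
        simp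
    intro n hn
    have : n ∈ Finset.univ.image g := by rw [himg]; simpa using hn
    simpa using this
  · refine Finset.card_le_card fun c hc => ?_
    simp only [Finset.mem_filter, Finset.mem_univ, true_and] at hc ⊢
    rcases Prod.Lex.toLex_le_toLex.1 hc with h | h
    · exact h.le
    · exact h.1.le

theorem exists_isGuess_le_card_filter_le {X V β : Type*} [Fintype X] [LinearOrder β]
    (f : V → X → β) :
    ∃ G : V → X → ℕ, IsGuess G ∧
      ∀ v x, G v x ≤ (Finset.univ.filter fun x' => f v x' ≤ f v x).card := by
  choose G hG hle using fun v => exists_bijOn_le_card_filter_le (f v)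
  exact ⟨G, hG, hle⟩

theorem IsGuess.one_le {X V : Type*} [Fintype X] {G : V → X → ℕ} (hG : IsGuess G) (v : V) (x : X) :
    1 ≤ G v x :=
  ((hG v).mapsTo (Set.mem_univ x)).1

theorem IsGuess.card_filter_le {X V : Type*} [Fintype X] {G : V → X → ℕ} (hG : IsGuess G)
    (v : V) (k : ℕ) : (Finset.univ.filter fun x => G v x ≤ k).card ≤ k := by
  have h := Finset.card_le_card_of_injOn (s := Finset.univ.filter fun x => G v x ≤ k)
    (t := Finset.Icc 1 k) (G v)
    (fun x hx => by
      have : G v x ≤ k := by simpa using hx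
      simpa using ⟨hG.one_le v x, this⟩)
    (fun a _ b _ hab => (hG v).injOn (Set.mem_univ a) (Set.mem_univ b) hab)
  simpa using h

/-- Dropping side information in `W` multiplies the number of guesses by at most `|W|`. -/
theorem IsGuess.exists_le_card_mul {X V W : Type*} [Fintype X] [Fintype W] [Nonempty W]
    {G : V × W → X → ℕ} (hG : IsGuess G) :
    ∃ G' : V → X → ℕ, IsGuess G' ∧ ∀ v w x, G' v x ≤ Fintype.card W * G (v, w) x := by
  classical
  obtain ⟨G', hG', hle⟩ := exists_isGuess_le_card_filter_le
    fun (v : V) (x : X) => Finset.univ.inf' Finset.univ_nonempty fun w : W => G (v, w) x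
  refine ⟨G', hG', fun v w x => (hle v x).trans ?_⟩
  refine (Finset.card_le_card (t := Finset.univ.biUnion fun w' : W =>
    Finset.univ.filter fun x' => G (v, w') x' ≤ G (v, w) x) fun x' hx' => ?_).trans
    (Finset.card_biUnion_le_card_mul _ _ _ fun w' _ => hG.card_filter_le _ _)
  obtain ⟨w', -, hw'⟩ := Finset.exists_mem_eq_inf' Finset.univ_nonempty fun w : W => G (v, w) x'
  simp only [Finset.mem_filter, Finset.mem_univ, true_and, Finset.mem_biUnion] at hx' ⊢
  exact ⟨w', hw' ▸ hx'.trans (Finset.inf'_le _ (Finset.mem_univ w))⟩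

theorem IsGuess.sum_inv_le {X V : Type*} [Fintype X] {G : V → X → ℕ} (hG : IsGuess G) (v : V) :
    ∑ x, ((G v x : ℝ))⁻¹ ≤ 1 + Real.log (Fintype.card X) := by
  refine le_trans (le_of_eq ?_) (harmonic_le_one_add_log _)
  rw [harmonic_eq_sum_Icc]
  push_cast
  refine Finset.sum_nbij (G v) (fun x _ => ?_) (fun a _ b _ h => ?_) (fun n hn => ?_)
    fun _ _ => rfl
  · simpa using (hG v).mapsTo (Set.mem_univ x)
  · exact (hG v).injOn (Set.mem_univ a) (Set.mem_univ b) h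
  · simpa using (hG v).surjOn (by simpa using hn)

/-- Arikan's lower bound on guessing moments. -/
theorem IsGuess.rpow_sum_le {X V : Type*} [Fintype X] {G : V → X → ℕ} (hG : IsGuess G) (v : V)
    {ρ : ℝ} (hρ : 0 < ρ) {q : X → ℝ} (hq : ∀ x, 0 ≤ q x) :
    (∑ x, q x ^ (1 / (1 + ρ))) ^ (1 + ρ) ≤
      (1 + Real.log (Fintype.card X)) ^ ρ * ∑ x, q x * (G v x : ℝ) ^ ρ := by
  have hr : (0 : ℝ) < 1 + ρ := by linarith
  have hpos : ∀ x, (0 : ℝ) < G v x := fun x => by exact_mod_cast hG.one_le v x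
  have h := Real.inner_le_weight_mul_Lp_of_nonneg Finset.univ (p := 1 + ρ) (by linarith)
    (fun x => ((G v x : ℝ))⁻¹) (fun x => G v x * q x ^ (1 / (1 + ρ)))
    (fun x => (inv_pos.2 (hpos x)).le)
    (fun x => mul_nonneg (hpos x).le (Real.rpow_nonneg (hq x) _))
  have h₁ : ∀ x, ((G v x : ℝ))⁻¹ * (G v x * q x ^ (1 / (1 + ρ))) = q x ^ (1 / (1 + ρ)) :=
    fun x => inv_mul_cancel_left₀ (hpos x).ne' _
  have h₂ : ∀ x, ((G v x : ℝ))⁻¹ * (G v x * q x ^ (1 / (1 + ρ))) ^ (1 + ρ) =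
      q x * (G v x : ℝ) ^ ρ := fun x => by
    rw [Real.mul_rpow (hpos x).le (Real.rpow_nonneg (hq x) _), ← Real.rpow_mul (hq x),
      one_div_mul_cancel hr.ne', Real.rpow_one, Real.rpow_add (hpos x), Real.rpow_one]
    field_simp [(hpos x).ne']
  simp only [h₁, h₂] at h
  have hA : 0 ≤ ∑ x, ((G v x : ℝ))⁻¹ := Finset.sum_nonneg fun x _ => (inv_pos.2 (hpos x)).le
  have hB : 0 ≤ ∑ x, q x * (G v x : ℝ) ^ ρ :=
    Finset.sum_nonneg fun x _ => mul_nonneg (hq x) (Real.rpow_nonneg (hpos x).le _)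
  calc (∑ x, q x ^ (1 / (1 + ρ))) ^ (1 + ρ)
      ≤ ((∑ x, ((G v x : ℝ))⁻¹) ^ (1 - (1 + ρ)⁻¹) *
          (∑ x, q x * (G v x : ℝ) ^ ρ) ^ (1 + ρ)⁻¹) ^ (1 + ρ) :=
        Real.rpow_le_rpow (Finset.sum_nonneg fun x _ => Real.rpow_nonneg (hq x) _) h hr.le
    _ = (∑ x, ((G v x : ℝ))⁻¹) ^ ρ * ∑ x, q x * (G v x : ℝ) ^ ρ := by
        rw [Real.mul_rpow (Real.rpow_nonneg hA _) (Real.rpow_nonneg hB _), ← Real.rpow_mul hA,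
          ← Real.rpow_mul hB, inv_mul_cancel₀ hr.ne', Real.rpow_one, sub_mul,
          inv_mul_cancel₀ hr.ne', one_mul, add_sub_cancel_left]
    _ ≤ _ := mul_le_mul_of_nonneg_right
        (Real.rpow_le_rpow hA (hG.sum_inv_le v) hρ.le) hB

/-- Conditioning on a hint with values in `M` costs at most a factor `|M| ^ ρ`. -/
theorem rpow_sum_le_card_rpow_mul_sum {X M : Type*} [Fintype X] [Fintype M]
    {ρ : ℝ} (hρ : 0 < ρ) {q : X → ℝ} (hq : ∀ x, 0 ≤ q x) {e : X → M → ℝ}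
    (he0 : ∀ x m, 0 ≤ e x m) (he1 : ∀ x, ∑ m, e x m = 1) :
    (∑ x, q x ^ (1 / (1 + ρ))) ^ (1 + ρ) ≤
      (Fintype.card M : ℝ) ^ ρ * ∑ m, (∑ x, (q x * e x m) ^ (1 / (1 + ρ))) ^ (1 + ρ) := by
  have hr : (0 : ℝ) < 1 + ρ := by linarith
  have hle : ∑ x, q x ^ (1 / (1 + ρ)) ≤ ∑ m, ∑ x, (q x * e x m) ^ (1 / (1 + ρ)) := by
    rw [Finset.sum_comm]
    refine Finset.sum_le_sum fun x _ => ?_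
    simp_rw [Real.mul_rpow (hq x) (he0 x _), ← Finset.mul_sum]
    refine le_mul_of_one_le_right (Real.rpow_nonneg (hq x) _) ?_
    refine (he1 x).symm.trans_le (Finset.sum_le_sum fun m _ => ?_)
    have hm : e x m ≤ 1 := he1 x ▸
      Finset.single_le_sum (fun m' _ => he0 x m') (Finset.mem_univ m)
    exact Real.self_le_rpow_of_le_one (he0 x m) hm
      (by rw [div_le_one hr]; linarith)
  refine (Real.rpow_le_rpow (Finset.sum_nonneg fun x _ => Real.rpow_nonneg (hq x) _)
    hle hr.le).trans ?_
  have := Real.rpow_sum_le_const_mul_sum_rpow_of_nonneg Finset.univ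
    (f := fun m => ∑ x, (q x * e x m) ^ (1 / (1 + ρ))) (p := 1 + ρ) (by linarith)
    fun m _ => Finset.sum_nonneg fun x _ => Real.rpow_nonneg (mul_nonneg (hq x) (he0 x m)) _
  simpa using this

/-- Arikan's upper bound: guessing in decreasing order of probability. -/
theorem exists_isGuess_sum_le {X V : Type*} [Fintype X] {ρ : ℝ} (hρ : 0 < ρ)
    {q : V → X → ℝ} (hq : ∀ v x, 0 ≤ q v x) :
    ∃ G : V → X → ℕ, IsGuess G ∧ ∀ v,
      ∑ x, q v x * (G v x : ℝ) ^ ρ ≤ (∑ x, q v x ^ (1 / (1 + ρ))) ^ (1 + ρ) := by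
  have hr : (0 : ℝ) < 1 + ρ := by linarith
  obtain ⟨G, hG, hle⟩ := exists_isGuess_le_card_filter_le fun v x => -q v x
  refine ⟨G, hG, fun v => ?_⟩
  set S := ∑ x, q v x ^ (1 / (1 + ρ)) with hS
  have hS0 : 0 ≤ S := Finset.sum_nonneg fun x _ => Real.rpow_nonneg (hq v x) _
  have hterm : ∀ x, q v x * (G v x : ℝ) ^ ρ ≤ q v x ^ (1 / (1 + ρ)) * S ^ ρ := fun x => by
    rcases (hq v x).eq_or_lt with h0 | h0
    · rw [← h0, zero_mul]
      exact mul_nonneg (Real.rpow_nonneg le_rfl _) (Real.rpow_nonneg hS0 _)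
    have hG' : q v x ^ (1 / (1 + ρ)) * G v x ≤ S := by
      calc q v x ^ (1 / (1 + ρ)) * G v x
          ≤ q v x ^ (1 / (1 + ρ)) * (Finset.univ.filter fun x' => -q v x' ≤ -q v x).card :=
            mul_le_mul_of_nonneg_left (by exact_mod_cast hle v x) (Real.rpow_nonneg h0.le _)
        _ = ∑ x' ∈ Finset.univ.filter fun x' => -q v x' ≤ -q v x, q v x ^ (1 / (1 + ρ)) := by
            rw [Finset.sum_const, nsmul_eq_mul, mul_comm]
        _ ≤ ∑ x' ∈ Finset.univ.filter fun x' => -q v x' ≤ -q v x, q v x' ^ (1 / (1 + ρ)) := by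
            refine Finset.sum_le_sum fun x' hx' => Real.rpow_le_rpow h0.le ?_ (by positivity)
            simpa using hx'
        _ ≤ S := Finset.sum_le_sum_of_subset_of_nonneg (Finset.filter_subset _ _)
            fun x' _ _ => Real.rpow_nonneg (hq v x') _
    have hq' : q v x = q v x ^ (1 / (1 + ρ)) * (q v x ^ (1 / (1 + ρ))) ^ ρ := by
      rw [← Real.rpow_mul h0.le, ← Real.rpow_add h0]
      conv_lhs => rw [← Real.rpow_one (q v x)]
      congr 1
      field_simp
    calc q v x * (G v x : ℝ) ^ ρ
        = q v x ^ (1 / (1 + ρ)) * (q v x ^ (1 / (1 + ρ)) * G v x) ^ ρ := by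
          rw [Real.mul_rpow (Real.rpow_nonneg h0.le _) (Nat.cast_nonneg _), ← mul_assoc, ← hq']
      _ ≤ _ := mul_le_mul_of_nonneg_left (Real.rpow_le_rpow
          (mul_nonneg (Real.rpow_nonneg h0.le _) (Nat.cast_nonneg _)) hG' hρ.le)
          (Real.rpow_nonneg h0.le _)
  calc ∑ x, q v x * (G v x : ℝ) ^ ρ ≤ ∑ x, q v x ^ (1 / (1 + ρ)) * S ^ ρ :=
        Finset.sum_le_sum fun x _ => hterm x
    _ = S ^ (1 + ρ) := by
        rw [← Finset.sum_mul, Real.rpow_add' hS0 hr.ne', Real.rpow_one]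

/-- The sum inside the logarithm defining `condRenyi` is positive. -/
theorem sum_rpow_pos {X Y : Type*} [Fintype X] [Fintype Y] {ρ : ℝ} {p : X → Y → ℝ}
    (hp0 : ∀ x y, 0 ≤ p x y) (hp1 : ∑ x, ∑ y, p x y = 1) :
    0 < ∑ y, (∑ x, p x y ^ (1 / (1 + ρ))) ^ (1 + ρ) := by
  obtain ⟨x, -, hx⟩ := Finset.exists_ne_zero_of_sum_ne_zero (hp1.trans_ne one_ne_zero)
  obtain ⟨y, -, hxy⟩ := Finset.exists_ne_zero_of_sum_ne_zero hx
  have hs : ∀ y, 0 ≤ ∑ x, p x y ^ (1 / (1 + ρ)) := fun y =>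
    Finset.sum_nonneg fun x _ => Real.rpow_nonneg (hp0 x y) _
  refine Finset.sum_pos' (fun y _ => Real.rpow_nonneg (hs y) _) ⟨y, Finset.mem_univ y, ?_⟩
  refine Real.rpow_pos_of_pos (Finset.sum_pos' (fun x _ => Real.rpow_nonneg (hp0 x y) _)
    ⟨x, Finset.mem_univ x, Real.rpow_pos_of_pos ((hp0 x y).lt_of_ne' hxy) _⟩) _

theorem two_rpow_mul_condRenyi {X Y : Type*} [Fintype X] [Fintype Y] {ρ : ℝ} (hρ : 0 < ρ)
    {p : X → Y → ℝ} (hp0 : ∀ x y, 0 ≤ p x y) (hp1 : ∑ x, ∑ y, p x y = 1) :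
    (2 : ℝ) ^ (ρ * condRenyi ρ p) = ∑ y, (∑ x, p x y ^ (1 / (1 + ρ))) ^ (1 + ρ) := by
  have hr : (1 : ℝ) + ρ ≠ 0 := by linarith
  have hc : ρ * ((1 / (1 + ρ)) / (1 - 1 / (1 + ρ))) = 1 := by
    have : 1 - 1 / (1 + ρ) = ρ / (1 + ρ) := by field_simp; ring
    rw [this]
    field_simp
  rw [condRenyi, ← mul_assoc, hc, one_mul, one_div_one_div,
    Real.rpow_logb (by norm_num) (by norm_num) (sum_rpow_pos hp0 hp1)]

theorem bobGuessAmb_ge {𝒳 𝒴 M₁ M₂ : Type*} [Fintype 𝒳] [Fintype 𝒴] [Fintype M₁] [Fintype M₂]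
    {ρ c : ℝ} {p : 𝒳 → 𝒴 → ℝ} {e : 𝒳 → 𝒴 → M₁ × M₂ → ℝ}
    (h : ∀ G : 𝒴 × M₁ × M₂ → 𝒳 → ℕ, IsGuess G →
      c ≤ ∑ x, ∑ y, ∑ m : M₁ × M₂, p x y * e x y m * (G (y, m) x : ℝ) ^ ρ) :
    c ≤ bobGuessAmb ρ p e := by
  obtain ⟨G, hG, -⟩ := exists_isGuess_le_card_filter_le
    fun (_ : 𝒴 × M₁ × M₂) (_ : 𝒳) => (0 : ℕ)
  refine le_csInf ⟨_, G, hG, rfl⟩ ?_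
  rintro _ ⟨G, hG, rfl⟩
  exact h G hG

section Ambiguities

variable {𝒳 𝒴 M₁ M₂ : Type*} [Fintype 𝒳] [Fintype 𝒴] [Fintype M₁] [Fintype M₂]
  {ρ : ℝ} {p : 𝒳 → 𝒴 → ℝ} {e : 𝒳 → 𝒴 → M₁ × M₂ → ℝ}

theorem one_le_bobGuessAmb (hρ : 0 < ρ) (hp0 : ∀ x y, 0 ≤ p x y) (hp1 : ∑ x, ∑ y, p x y = 1)
    (he0 : ∀ x y m, 0 ≤ e x y m) (he1 : ∀ x y, ∑ m : M₁ × M₂, e x y m = 1) :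
    1 ≤ bobGuessAmb ρ p e := by
  refine bobGuessAmb_ge fun G hG => ?_
  calc (1 : ℝ) = ∑ x, ∑ y, ∑ m : M₁ × M₂, p x y * e x y m := by
        simp_rw [← Finset.mul_sum, he1, mul_one, hp1]
    _ ≤ _ := by
        refine Finset.sum_le_sum fun x _ => Finset.sum_le_sum fun y _ =>
          Finset.sum_le_sum fun m _ => le_mul_of_one_le_right
            (mul_nonneg (hp0 x y) (he0 x y m)) (Real.one_le_rpow ?_ hρ.le)
        exact_mod_cast hG.one_le (y, m) x

theorem two_rpow_condRenyi_le_mul_bobGuessAmb (hρ : 0 < ρ)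
    (hp0 : ∀ x y, 0 ≤ p x y) (hp1 : ∑ x, ∑ y, p x y = 1)
    (he0 : ∀ x y m, 0 ≤ e x y m) (he1 : ∀ x y, ∑ m : M₁ × M₂, e x y m = 1) :
    (2 : ℝ) ^ (ρ * condRenyi ρ p) ≤ bobGuessAmb ρ p e *
      (((Fintype.card M₁ * Fintype.card M₂ : ℕ) : ℝ) ^ ρ *
        (1 + Real.log (Fintype.card 𝒳)) ^ ρ) := by
  obtain ⟨x, -, hx⟩ := Finset.exists_ne_zero_of_sum_ne_zero (hp1.trans_ne one_ne_zero)
  obtain ⟨y, -, -⟩ := Finset.exists_ne_zero_of_sum_ne_zero hx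
  obtain ⟨m, -, -⟩ := Finset.exists_ne_zero_of_sum_ne_zero ((he1 x y).trans_ne one_ne_zero)
  have : Nonempty M₁ := ⟨m.1⟩
  have : Nonempty M₂ := ⟨m.2⟩
  have hM : (0 : ℝ) < ((Fintype.card M₁ * Fintype.card M₂ : ℕ) : ℝ) :=
    Nat.cast_pos.2 (Nat.mul_pos Fintype.card_pos Fintype.card_pos)
  have hL : 0 < 1 + Real.log (Fintype.card 𝒳) := by
    have := Real.log_natCast_nonneg (Fintype.card 𝒳)
    linarith
  have hc := mul_pos (Real.rpow_pos_of_pos hM ρ) (Real.rpow_pos_of_pos hL ρ)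
  rw [← div_le_iff₀ hc]
  refine bobGuessAmb_ge fun G hG => ?_
  rw [div_le_iff₀ hc, two_rpow_mul_condRenyi hρ hp0 hp1, mul_comm, mul_assoc, Finset.sum_comm,
    Finset.mul_sum, Finset.mul_sum]
  refine Finset.sum_le_sum fun y _ => ?_
  refine (rpow_sum_le_card_rpow_mul_sum hρ (hp0 · y) (he0 · y) (he1 · y)).trans ?_
  rw [Fintype.card_prod]
  refine mul_le_mul_of_nonneg_left ?_ (Real.rpow_nonneg hM.le _)
  rw [Finset.sum_comm, Finset.mul_sum]
  exact Finset.sum_le_sum fun m _ =>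
    hG.rpow_sum_le (y, m) hρ fun x => mul_nonneg (hp0 x y) (he0 x y m)

theorem eveAmbAlt_le_left (hp0 : ∀ x y, 0 ≤ p x y) (he0 : ∀ x y m, 0 ≤ e x y m)
    {G : 𝒴 × M₁ → 𝒳 → ℕ} (hG : IsGuess G) :
    eveAmbAlt ρ p e ≤
      ∑ x, ∑ y, ∑ m : M₁ × M₂, p x y * e x y m * (G (y, m.1) x : ℝ) ^ ρ := by
  refine (min_le_left _ _).trans (csInf_le ⟨0, ?_⟩ ⟨G, hG, ?_⟩)
  · rintro _ ⟨G, -, rfl⟩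
    exact Finset.sum_nonneg fun x _ => Finset.sum_nonneg fun y _ => Finset.sum_nonneg fun m₁ _ =>
      Finset.sum_nonneg fun m₂ _ => mul_nonneg (mul_nonneg (hp0 _ _) (he0 _ _ _))
        (Real.rpow_nonneg (Nat.cast_nonneg _) _)
  · simp_rw [Fintype.sum_prod_type]

theorem eveAmbAlt_le_right (hp0 : ∀ x y, 0 ≤ p x y) (he0 : ∀ x y m, 0 ≤ e x y m)
    {G : 𝒴 × M₂ → 𝒳 → ℕ} (hG : IsGuess G) :
    eveAmbAlt ρ p e ≤
      ∑ x, ∑ y, ∑ m : M₁ × M₂, p x y * e x y m * (G (y, m.2) x : ℝ) ^ ρ := by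
  refine (min_le_right _ _).trans (csInf_le ⟨0, ?_⟩ ⟨G, hG, ?_⟩)
  · rintro _ ⟨G, -, rfl⟩
    exact Finset.sum_nonneg fun x _ => Finset.sum_nonneg fun y _ => Finset.sum_nonneg fun m₁ _ =>
      Finset.sum_nonneg fun m₂ _ => mul_nonneg (mul_nonneg (hp0 _ _) (he0 _ _ _))
        (Real.rpow_nonneg (Nat.cast_nonneg _) _)
  · simp_rw [Fintype.sum_prod_type]

theorem eveAmbAlt_le_two_rpow_condRenyi (hρ : 0 < ρ)
    (hp0 : ∀ x y, 0 ≤ p x y) (hp1 : ∑ x, ∑ y, p x y = 1)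
    (he0 : ∀ x y m, 0 ≤ e x y m) (he1 : ∀ x y, ∑ m : M₁ × M₂, e x y m = 1) :
    eveAmbAlt ρ p e ≤ (2 : ℝ) ^ (ρ * condRenyi ρ p) := by
  obtain ⟨G, hG, hle⟩ := exists_isGuess_sum_le hρ fun (y : 𝒴) (x : 𝒳) => hp0 x y
  have hG' : IsGuess fun (v : 𝒴 × M₁) => G v.1 := fun v => hG v.1
  refine (eveAmbAlt_le_left hp0 he0 hG').trans ?_
  rw [two_rpow_mul_condRenyi hρ hp0 hp1, Finset.sum_comm]
  refine Finset.sum_le_sum fun y _ => le_trans (le_of_eq ?_) (hle y)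
  refine Finset.sum_congr rfl fun x _ => ?_
  change ∑ m, p x y * e x y m * (G y x : ℝ) ^ ρ = _
  rw [← Finset.sum_mul, ← Finset.mul_sum, he1, mul_one]

theorem sum_le_rpow_mul_sum_of_le_mul (hρ : 0 < ρ)
    (hp0 : ∀ x y, 0 ≤ p x y) (he0 : ∀ x y m, 0 ≤ e x y m) {k : ℕ}
    {G G' : 𝒴 → M₁ × M₂ → 𝒳 → ℕ} (h : ∀ y m x, G' y m x ≤ k * G y m x) :
    ∑ x, ∑ y, ∑ m : M₁ × M₂, p x y * e x y m * (G' y m x : ℝ) ^ ρ ≤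
      (k : ℝ) ^ ρ * ∑ x, ∑ y, ∑ m : M₁ × M₂, p x y * e x y m * (G y m x : ℝ) ^ ρ := by
  simp_rw [Finset.mul_sum]
  refine Finset.sum_le_sum fun x _ => Finset.sum_le_sum fun y _ => Finset.sum_le_sum fun m _ => ?_
  rw [mul_left_comm, ← Real.mul_rpow (Nat.cast_nonneg _) (Nat.cast_nonneg _)]
  refine mul_le_mul_of_nonneg_left (Real.rpow_le_rpow (Nat.cast_nonneg _) ?_ hρ.le)
    (mul_nonneg (hp0 x y) (he0 x y m))
  exact_mod_cast h y m x

theorem eveAmbAlt_le_mul_bobGuessAmb [Nonempty M₁] [Nonempty M₂] (hρ : 0 < ρ)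
    (hp0 : ∀ x y, 0 ≤ p x y) (he0 : ∀ x y m, 0 ≤ e x y m) :
    eveAmbAlt ρ p e ≤
      ((min (Fintype.card M₁) (Fintype.card M₂) : ℕ) : ℝ) ^ ρ * bobGuessAmb ρ p e := by
  have hk : (0 : ℝ) < ((min (Fintype.card M₁) (Fintype.card M₂) : ℕ) : ℝ) :=
    Nat.cast_pos.2 (lt_min Fintype.card_pos Fintype.card_pos)
  rw [← div_le_iff₀' (Real.rpow_pos_of_pos hk ρ)]
  refine bobGuessAmb_ge fun G hG => ?_
  rw [div_le_iff₀' (Real.rpow_pos_of_pos hk ρ)]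
  rcases le_total (Fintype.card M₁) (Fintype.card M₂) with h | h
  · rw [min_eq_left h]
    have hG₂ : IsGuess fun v : (𝒴 × M₂) × M₁ => G (v.1.1, v.2, v.1.2) := fun v => hG _
    obtain ⟨G', hG', hle⟩ := hG₂.exists_le_card_mul
    exact (eveAmbAlt_le_right hp0 he0 hG').trans
      (sum_le_rpow_mul_sum_of_le_mul (G := fun y m => G (y, m))
        (G' := fun y m => G' (y, m.2)) hρ hp0 he0 fun y m x => hle (y, m.2) m.1 x)
  · rw [min_eq_right h]
    have hG₁ : IsGuess fun v : (𝒴 × M₁) × M₂ => G (v.1.1, v.1.2, v.2) := fun v => hG _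
    obtain ⟨G', hG', hle⟩ := hG₁.exists_le_card_mul
    exact (eveAmbAlt_le_left hp0 he0 hG').trans
      (sum_le_rpow_mul_sum_of_le_mul (G := fun y m => G (y, m))
        (G' := fun y m => G' (y, m.1)) hρ hp0 he0 fun y m x => hle (y, m.1) m.2 x)

theorem eveAmb_le_eveAmbAlt (hρ : 0 < ρ) (hp0 : ∀ x y, 0 ≤ p x y)
    (he0 : ∀ x y m, 0 ≤ e x y m) : eveAmb ρ p e ≤ eveAmbAlt ρ p e := by
  obtain ⟨F₁, hF₁, -⟩ := exists_isGuess_le_card_filter_le fun (_ : 𝒴 × M₁) (_ : 𝒳) => (0 : ℕ)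
  obtain ⟨F₂, hF₂, -⟩ := exists_isGuess_le_card_filter_le fun (_ : 𝒴 × M₂) (_ : 𝒳) => (0 : ℕ)
  have hle : ∀ (G₁ : 𝒴 × M₁ → 𝒳 → ℕ) (G₂ : 𝒴 × M₂ → 𝒳 → ℕ), IsGuess G₁ → IsGuess G₂ →
      eveAmb ρ p e ≤ ∑ x : 𝒳, ∑ y : 𝒴, ∑ m₁ : M₁, ∑ m₂ : M₂, p x y * e x y (m₁, m₂) *
        ((min (G₁ (y, m₁) x) (G₂ (y, m₂) x) : ℕ) : ℝ) ^ ρ := fun G₁ G₂ h₁ h₂ => by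
    refine csInf_le ⟨0, ?_⟩ ⟨G₁, G₂, h₁, h₂, rfl⟩
    rintro _ ⟨G₁, G₂, -, -, rfl⟩
    exact Finset.sum_nonneg fun x _ => Finset.sum_nonneg fun y _ => Finset.sum_nonneg fun m₁ _ =>
      Finset.sum_nonneg fun m₂ _ => mul_nonneg (mul_nonneg (hp0 _ _) (he0 _ _ _))
        (Real.rpow_nonneg (Nat.cast_nonneg _) _)
  refine le_min (le_csInf ⟨_, F₁, hF₁, rfl⟩ ?_) (le_csInf ⟨_, F₂, hF₂, rfl⟩ ?_)
  · rintro _ ⟨G, hG, rfl⟩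
    refine (hle G F₂ hG hF₂).trans ?_
    gcongr with x _ y _ m₁ _ m₂ _
    · exact mul_nonneg (hp0 _ _) (he0 _ _ _)
    · exact min_le_left _ _
  · rintro _ ⟨G, hG, rfl⟩
    refine (hle F₁ G hF₁ hG).trans ?_
    gcongr with x _ y _ m₁ _ m₂ _
    · exact mul_nonneg (hp0 _ _) (he0 _ _ _)
    · exact min_le_right _ _

end Ambiguities

/-- Theorem 5 (finite-blocklength guessing version), converse part. -/
theorem distributed_storage_guessing_converse
    {𝒳 𝒴 M₁ M₂ : Type*} [Fintype 𝒳] [Fintype 𝒴] [Fintype M₁] [Fintype M₂]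
    (ρ : ℝ) (hρ : 0 < ρ)
    (p : 𝒳 → 𝒴 → ℝ) (hp0 : ∀ x y, 0 ≤ p x y) (hp1 : ∑ x : 𝒳, ∑ y : 𝒴, p x y = 1)
    (e : 𝒳 → 𝒴 → M₁ × M₂ → ℝ)
    (he0 : ∀ x y m, 0 ≤ e x y m) (he1 : ∀ x y, ∑ m : M₁ × M₂, e x y m = 1) :
    bobGuessAmb ρ p e ≥
      max ((1 + Real.log (Fintype.card 𝒳)) ^ (-ρ) *
        (2 : ℝ) ^ (ρ * (condRenyi ρ p -
          Real.logb 2 ((Fintype.card M₁ * Fintype.card M₂ : ℕ) : ℝ)))) 1 ∧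
    eveAmbAlt ρ p e ≤
      min (((min (Fintype.card M₁) (Fintype.card M₂) : ℕ) : ℝ) ^ ρ * bobGuessAmb ρ p e)
        ((2 : ℝ) ^ (ρ * condRenyi ρ p)) ∧
    eveAmb ρ p e ≤ eveAmbAlt ρ p e ∧
    eveAmb ρ p e ≤
      min (((min (Fintype.card M₁) (Fintype.card M₂) : ℕ) : ℝ) ^ ρ * bobGuessAmb ρ p e)
        ((2 : ℝ) ^ (ρ * condRenyi ρ p)) := by
  obtain ⟨x, -, hx⟩ := Finset.exists_ne_zero_of_sum_ne_zero (hp1.trans_ne one_ne_zero)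
  obtain ⟨y, -, -⟩ := Finset.exists_ne_zero_of_sum_ne_zero hx
  obtain ⟨m, -, -⟩ := Finset.exists_ne_zero_of_sum_ne_zero ((he1 x y).trans_ne one_ne_zero)
  have : Nonempty M₁ := ⟨m.1⟩
  have : Nonempty M₂ := ⟨m.2⟩
  have hM : (0 : ℝ) < ((Fintype.card M₁ * Fintype.card M₂ : ℕ) : ℝ) :=
    Nat.cast_pos.2 (Nat.mul_pos Fintype.card_pos Fintype.card_pos)
  have hL : 0 < 1 + Real.log (Fintype.card 𝒳) := by
    have := Real.log_natCast_nonneg (Fintype.card 𝒳)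
    linarith
  have hAlt := le_min (eveAmbAlt_le_mul_bobGuessAmb hρ hp0 he0)
    (eveAmbAlt_le_two_rpow_condRenyi hρ hp0 hp1 he0 he1)
  have hEve := eveAmb_le_eveAmbAlt hρ hp0 he0
  refine ⟨max_le ?_ (one_le_bobGuessAmb hρ hp0 hp1 he0 he1), hAlt, hEve, hEve.trans hAlt⟩
  have h := two_rpow_condRenyi_le_mul_bobGuessAmb hρ hp0 hp1 he0 he1
  rw [mul_sub, Real.rpow_sub two_pos, mul_comm ρ (Real.logb _ _), Real.rpow_mul two_pos.le (Real.logb _ _),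
    Real.rpow_logb two_pos (by norm_num) hM, Real.rpow_neg hL.le, ← div_eq_inv_mul, div_div]
  exact (div_le_iff₀ (mul_pos (Real.rpow_pos_of_pos hM ρ) (Real.rpow_pos_of_pos hL ρ))).2 h
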